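/- arXiv:1309.2715 — 3 statements merged into one kernel-verified Lean document; each statement's English description precedes it below -/
import Mathlib

section
/- For every integer α ≥ 0 and every v ∈ ℝ, ∫_ℝ g(w) (2π)⁻¹∫₀^{2π} H_α(v cos θ + w sin θ) dθ dw = s_α H_α(v), where s_α = (2π)⁻¹∫₀^{2π} cosᵅ θ dθ; moreover s_α = 0 when α is odd and s_{2α} = (2α)!/(4ᵅ (α!)²). -/
open MeasureTheory Real
open scoped BigOperators

noncomputable section

/-- standard Gaussian density on ℝ -/
def g (v : ℝ) : ℝ := (Real.sqrt (2 * Real.pi))⁻¹ * Real.exp (-v ^ 2 / 2)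

/-- product Gaussian density on ℝᴺ -/
def gam (N : ℕ) (v : Fin N → ℝ) : ℝ := ∏ i, g (v i)

/-- the Gaussian measure γ(v)dv on ℝᴺ -/
def gmeas (N : ℕ) : Measure (Fin N → ℝ) :=
  volume.withDensity (fun v => ENNReal.ofReal (gam N v))

/-- average over θ ∈ [0, 2π] -/
def avg (F : ℝ → ℝ) : ℝ := (2 * Real.pi)⁻¹ * ∫ θ in (0:ℝ)..(2 * Real.pi), F θ

/-- v with coordinates i,j rotated by angle θ -/
def rot (N : ℕ) (v : Fin N → ℝ) (i j : Fin N) (θ : ℝ) : Fin N → ℝ :=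
  Function.update (Function.update v i (v i * Real.cos θ + v j * Real.sin θ)) j
    (-(v i) * Real.sin θ + v j * Real.cos θ)

/-- the Kac collision operator Q -/
def Qop (N : ℕ) (h : (Fin N → ℝ) → ℝ) (v : Fin N → ℝ) : ℝ :=
  ((N.choose 2 : ℝ))⁻¹ * ∑ i : Fin N, ∑ j : Fin N,
    if i < j then avg (fun θ => h (rot N v i j θ)) else 0

/-- 𝓛_K = N (I - Q) -/
def LK (N : ℕ) (h : (Fin N → ℝ) → ℝ) (v : Fin N → ℝ) : ℝ :=
  (N : ℝ) * (h v - Qop N h v)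

/-- v with j-th coordinate replaced by v_j cos θ + w sin θ -/
def rotw (N : ℕ) (v : Fin N → ℝ) (j : Fin N) (θ w : ℝ) : Fin N → ℝ :=
  Function.update v j (v j * Real.cos θ + w * Real.sin θ)

/-- the thermostat operator T_j -/
def Tj (N : ℕ) (j : Fin N) (h : (Fin N → ℝ) → ℝ) (v : Fin N → ℝ) : ℝ :=
  ∫ w : ℝ, g w * avg (fun θ => h (rotw N v j θ w))

/-- 𝓛_T = Σ_j (I - T_j) -/
def LTherm (N : ℕ) (h : (Fin N → ℝ) → ℝ) (v : Fin N → ℝ) : ℝ :=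
  ∑ j : Fin N, (h v - Tj N j h v)

/-- inner product on L²(ℝᴺ, γ dv) -/
def iprod (N : ℕ) (h₁ h₂ : (Fin N → ℝ) → ℝ) : ℝ :=
  ∫ v : Fin N → ℝ, h₁ v * h₂ v * gam N v

/-- probabilist's Hermite polynomial H_α(v) = (−1)ᵅ e^{v²/2} (d/dv)ᵅ e^{−v²/2} -/
def Herm (n : ℕ) (v : ℝ) : ℝ :=
  (-1 : ℝ) ^ n * Real.exp (v ^ 2 / 2) * iteratedDeriv n (fun x => Real.exp (-x ^ 2 / 2)) v

/-- s_n = (2π)⁻¹ ∫₀^{2π} cosⁿ θ dθ -/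
def sCoef (n : ℕ) : ℝ := avg (fun θ => Real.cos θ ^ n)

/-- the master-equation thermostat operator R_j acting on densities -/
def Rop (N : ℕ) (j : Fin N) (f : (Fin N → ℝ) → ℝ) (v : Fin N → ℝ) : ℝ :=
  ∫ w : ℝ, avg (fun θ =>
    g (-(v j) * Real.sin θ + w * Real.cos θ) * f (rotw N v j θ w))

/-- relative entropy S(f|γ) -/
def relEnt (N : ℕ) (f : (Fin N → ℝ) → ℝ) : ℝ :=
  ∫ v : Fin N → ℝ, f v * Real.log (f v / gam N v)

open Polynomial in
theorem derivative_hermite_succ (n : ℕ) :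
    derivative (hermite (n + 1)) = ((n : ℤ[X]) + 1) * hermite n := by
  induction n with
  | zero => simp
  | succ n ih =>
    rw [hermite_succ (n + 1), derivative_sub, derivative_mul, derivative_X, ih, derivative_mul,
      hermite_succ n]
    simp
    ring

theorem Herm_eq_aeval (n : ℕ) (x : ℝ) : Herm n x = Polynomial.aeval x (Polynomial.hermite n) := by
  rw [Polynomial.hermite_eq_deriv_gaussian', Herm, iteratedDeriv_eq_iterate]
  simp only [neg_div]
  ring

theorem Herm_eq_eval (n : ℕ) (x : ℝ) :
    Herm n x = ((Polynomial.hermite n).map (Int.castRingHom ℝ)).eval x := by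
  rw [Herm_eq_aeval, Polynomial.eval_map, ← algebraMap_int_eq, Polynomial.aeval_def]

theorem Herm_zero (x : ℝ) : Herm 0 x = 1 := by simp [Herm_eq_eval]

theorem Herm_one (x : ℝ) : Herm 1 x = x := by simp [Herm_eq_eval]

theorem Herm_add_two (n : ℕ) (x : ℝ) :
    Herm (n + 2) x = x * Herm (n + 1) x - ((n : ℝ) + 1) * Herm n x := by
  simp only [Herm_eq_aeval]
  rw [Polynomial.hermite_succ (n + 1), derivative_hermite_succ]
  simp

theorem integral_g : ∫ w, g w = 1 := by
  have h := integral_gaussian (1 / 2)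
  have e : ∀ w : ℝ, -w ^ 2 / 2 = -(1 / 2) * w ^ 2 := fun w => by ring
  simp only [g, integral_const_mul, e]
  rw [h, show π / (1 / 2) = 2 * π by ring]
  exact inv_mul_cancel₀ (by positivity)

theorem hasDerivAt_g (w : ℝ) : HasDerivAt g (-(w * g w)) w := by
  have h : HasDerivAt (fun x : ℝ => -x ^ 2 / 2) (-w) w := by
    refine ((hasDerivAt_pow 2 w).fun_neg.div_const 2).congr_deriv ?_
    simp only [Nat.cast_ofNat, Nat.add_one_sub_one, pow_one]
    ring
  refine (h.exp.const_mul (√(2 * π))⁻¹).congr_deriv ?_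
  simp only [g]
  ring

theorem integrable_g_mul_pow (n : ℕ) : Integrable fun w => g w * w ^ n := by
  have h := (integrable_rpow_mul_exp_neg_mul_sq (b := 1 / 2) (by norm_num) (s := n)
    (by linarith [n.cast_nonneg (α := ℝ)])).const_mul (√(2 * π))⁻¹
  refine h.congr (.of_forall fun w => ?_)
  simp only [g, rpow_natCast, show -w ^ 2 / 2 = -(1 / 2) * w ^ 2 by ring]
  ring

open Polynomial in
theorem integrable_g_mul_eval (P : ℝ[X]) : Integrable fun w => g w * P.eval w := by
  simp only [eval_eq_sum_range, Finset.mul_sum]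
  refine integrable_finsetSum _ fun i _ => ?_
  refine ((integrable_g_mul_pow i).const_mul (P.coeff i)).congr (.of_forall fun w => ?_)
  simp only
  ring

open Polynomial in
theorem integral_g_mul_id_mul_eval (P : ℝ[X]) :
    ∫ w, g w * (w * P.eval w) = ∫ w, g w * (derivative P).eval w := by
  have h := integral_mul_deriv_eq_deriv_mul_of_integrable
    (u := fun w => P.eval w) (u' := fun w => (derivative P).eval w) (v := g)
    (v' := fun w => -(w * g w)) (fun w _ => P.hasDerivAt w) (fun w _ => hasDerivAt_g w)
    ((integrable_g_mul_eval (-(X * P))).congr (.of_forall fun w => by simp; ring))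
    ((integrable_g_mul_eval (derivative P)).congr (.of_forall fun w => by simp; ring))
    ((integrable_g_mul_eval P).congr (.of_forall fun w => by simp; ring))
  calc ∫ w, g w * (w * P.eval w) = -∫ w, P.eval w * -(w * g w) := by
        rw [← integral_neg]; congr 1; ext w; ring
    _ = ∫ w, g w * (derivative P).eval w := by
        rw [h, neg_neg]; congr 1; ext w; ring

open Polynomial in
theorem integrable_g_mul_Herm_affine (n : ℕ) (a s : ℝ) :
    Integrable fun w => g w * Herm n (a + w * s) := by
  refine (integrable_g_mul_eval
    (((hermite n).map (Int.castRingHom ℝ)).comp (C a + X * C s))).congr (.of_forall fun w => ?_)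
  simp only [Herm_eq_eval, eval_comp, eval_add, eval_mul, eval_C, eval_X]

open Polynomial in
theorem integral_g_mul_id_mul_Herm_affine (n : ℕ) (a s : ℝ) :
    ∫ w, g w * (w * Herm (n + 1) (a + w * s))
      = s * ((n : ℝ) + 1) * ∫ w, g w * Herm n (a + w * s) := by
  have h := integral_g_mul_id_mul_eval
    (((hermite (n + 1)).map (Int.castRingHom ℝ)).comp (C a + X * C s))
  rw [derivative_comp, derivative_map, derivative_hermite_succ] at h
  simp only [eval_comp, eval_add, eval_mul, eval_C, eval_X, Polynomial.map_mul,
    ← Herm_eq_eval] at h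
  rw [h, ← integral_const_mul]
  congr 1
  ext w
  simp
  ring

/-- Averaging a Hermite polynomial over a Gaussian rotation. -/
theorem integral_g_mul_Herm_rotation (c s : ℝ) (hcs : c ^ 2 + s ^ 2 = 1) (v : ℝ) (n : ℕ) :
    ∫ w, g w * Herm n (v * c + w * s) = c ^ n * Herm n v := by
  induction n using Nat.twoStepInduction with
  | zero => simp [Herm_zero, integral_g]
  | one =>
    have h₁ := integrable_g_mul_pow 1
    have h₀ := integrable_g_mul_pow 0
    have h := integral_g_mul_id_mul_eval 1
    simp only [pow_one, pow_zero, mul_one] at h₁ h₀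
    simp at h
    simp only [Herm_one, mul_add, ← mul_assoc]
    rw [integral_add ((h₀.mul_const v).mul_const c) (h₁.mul_const s)]
    simp only [integral_mul_const, integral_g, h]
    ring
  | more n ih₀ ih₁ =>
    have hi₀ := integrable_g_mul_Herm_affine n (v * c) s
    have hi₁ := integrable_g_mul_Herm_affine (n + 1) (v * c) s
    have hiX : Integrable fun w => g w * (w * Herm (n + 1) (v * c + w * s)) := by
      refine (integrable_g_mul_eval (Polynomial.X *
        ((Polynomial.hermite (n + 1)).map (Int.castRingHom ℝ)).comp
          (.C (v * c) + .X * .C s))).congr (.of_forall fun w => ?_)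
      simp only [Herm_eq_eval, Polynomial.eval_comp, Polynomial.eval_add, Polynomial.eval_mul,
        Polynomial.eval_C, Polynomial.eval_X]
    calc ∫ w, g w * Herm (n + 2) (v * c + w * s)
        = ∫ w, (v * c * (g w * Herm (n + 1) (v * c + w * s))
            + s * (g w * (w * Herm (n + 1) (v * c + w * s)))
            - ((n : ℝ) + 1) * (g w * Herm n (v * c + w * s))) := by
          congr 1; ext w; rw [Herm_add_two]; ring
      _ = v * c * (c ^ (n + 1) * Herm (n + 1) v)
            + s * (s * ((n : ℝ) + 1) * (c ^ n * Herm n v))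
            - ((n : ℝ) + 1) * (c ^ n * Herm n v) := by
          rw [integral_sub (by exact (hi₁.const_mul _).add (hiX.const_mul _)) (hi₀.const_mul _),
            integral_add (hi₁.const_mul _) (hiX.const_mul _)]
          simp only [integral_const_mul, integral_g_mul_id_mul_Herm_affine, ih₀, ih₁]
      _ = c ^ (n + 2) * Herm (n + 2) v := by
          rw [Herm_add_two]
          linear_combination ((n : ℝ) + 1) * c ^ n * Herm n v * hcs

open Polynomial in
theorem integrable_g_mul_eval_rotation (P : ℝ[X]) (v a b : ℝ) :
    Integrable (Function.uncurry fun θ w => g w * P.eval (v * cos θ + w * sin θ))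
      ((volume.restrict (Set.uIoc a b)).prod volume) := by
  have h (i j : ℕ) : Integrable (fun θ : ℝ => (v * cos θ) ^ i * sin θ ^ j)
      (volume.restrict (Set.uIoc a b)) :=
    (Continuous.intervalIntegrable (by fun_prop) a b).def'
  have hk (k : ℕ) : Integrable (fun z : ℝ × ℝ => g z.2 * (v * cos z.1 + z.2 * sin z.1) ^ k)
      ((volume.restrict (Set.uIoc a b)).prod volume) := by
    simp only [add_pow, Finset.mul_sum]
    refine integrable_finsetSum _ fun i _ => ?_
    refine (((h i (k - i)).mul_prod (integrable_g_mul_pow (k - i))).const_mul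
      (k.choose i : ℝ)).congr (.of_forall fun z => ?_)
    simp only [mul_pow]
    ring
  simp only [Function.uncurry_def, eval_eq_sum_range, Finset.mul_sum]
  refine integrable_finsetSum _ fun i _ => ?_
  refine ((hk i).const_mul (P.coeff i)).congr (.of_forall fun z => ?_)
  simp only
  ring

theorem integral_g_mul_avg_Herm (n : ℕ) (v : ℝ) :
    ∫ w, g w * avg (fun θ => Herm n (v * cos θ + w * sin θ)) = sCoef n * Herm n v := by
  have hi := integrable_g_mul_eval_rotation
    ((Polynomial.hermite n).map (Int.castRingHom ℝ)) v 0 (2 * π)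
  simp only [← Herm_eq_eval] at hi
  have h := intervalIntegral_integral_swap hi
  simp only [integral_g_mul_Herm_rotation _ _ (cos_sq_add_sin_sq _),
    intervalIntegral.integral_const_mul, intervalIntegral.integral_mul_const] at h
  simp only [avg, sCoef, mul_left_comm _ (2 * π)⁻¹, integral_const_mul]
  rw [← h, mul_assoc]

theorem sCoef_zero : sCoef 0 = 1 := by
  simp only [sCoef, avg, pow_zero, intervalIntegral.integral_const, sub_zero, smul_eq_mul, mul_one]
  exact inv_mul_cancel₀ two_pi_pos.ne'

theorem sCoef_one : sCoef 1 = 0 := by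
  simp [sCoef, avg]

theorem sCoef_add_two (n : ℕ) : sCoef (n + 2) = ((n : ℝ) + 1) / (n + 2) * sCoef n := by
  simp only [sCoef, avg, integral_cos_pow, sin_two_pi, sin_zero]
  ring

theorem sCoef_two_mul_add_one (n : ℕ) : sCoef (2 * n + 1) = 0 := by
  induction n with
  | zero => simp [sCoef_one]
  | succ n ih => rw [show 2 * (n + 1) + 1 = 2 * n + 1 + 2 by ring, sCoef_add_two, ih, mul_zero]

theorem sCoef_two_mul (n : ℕ) :
    sCoef (2 * n) = ((2 * n).factorial : ℝ) / (4 ^ n * (n.factorial : ℝ) ^ 2) := by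
  induction n with
  | zero => simp [sCoef_zero]
  | succ n ih =>
    rw [show 2 * (n + 1) = 2 * n + 2 by ring, sCoef_add_two, ih, Nat.factorial_succ (2 * n + 1),
      Nat.factorial_succ (2 * n), Nat.factorial_succ n]
    have := n.factorial_ne_zero
    push_cast
    field_simp
    ring

/-- the Hermite polynomials diagonalize the one-particle thermostat
operator, T[H_α] = s_α H_α, with s_α = 0 for odd α and s_{2α} = (2α)!/(4^α (α!)²). -/
theorem hermite_eigenfunctions_of_T (α : ℕ) (v : ℝ) :
    (∫ w : ℝ, g w * avg (fun θ => Herm α (v * Real.cos θ + w * Real.sin θ)))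
      = sCoef α * Herm α v
    ∧ (Odd α → sCoef α = 0)
    ∧ sCoef (2 * α)
        = (Nat.factorial (2 * α) : ℝ) / (4 ^ α * (Nat.factorial α : ℝ) ^ 2) := by
  refine ⟨integral_g_mul_avg_Herm α v, ?_, sCoef_two_mul α⟩
  rintro ⟨k, rfl⟩
  exact sCoef_two_mul_add_one k

end
end

section
/- Let G : ℝ → [0,∞) be measurable with ∫_ℝ G(v) g(v) dv = 1, and define T[G](v) = ∫_ℝ g(w) (2π)⁻¹∫₀^{2π} G(v cos θ + w sin θ) dθ dw. Then ∫_ℝ g(v) T[G](v) log T[G](v) dv ≤ (1/2) ∫_ℝ g(v) G(v) log G(v) dv. -/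
open MeasureTheory Real
open scoped BigOperators

noncomputable section

/-- A nonnegative integrable function may be replaced by its partial integral when tested against a
function of the first variable. -/
theorem integrable_mul_comp_fst {X Y : Type*} [MeasurableSpace X] [MeasurableSpace Y]
    {m : Measure X} {n : Measure Y} [SFinite m] [SFinite n] {F : X × Y → ℝ}
    (hF0 : ∀ p, 0 ≤ F p) (hF : Integrable F (m.prod n)) {ψ : X → ℝ} (hψ : Measurable ψ)
    (h : Integrable (fun x => (∫ y, F (x, y) ∂n) * ψ x) m) :
    Integrable (fun p : X × Y => F p * ψ p.1) (m.prod n) ∧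
      ∫ p, F p * ψ p.1 ∂(m.prod n) = ∫ x, (∫ y, F (x, y) ∂n) * ψ x ∂m := by
  have hint : Integrable (fun p : X × Y => F p * ψ p.1) (m.prod n) := by
    have hm : AEStronglyMeasurable (fun p : X × Y => F p * ψ p.1) (m.prod n) :=
      hF.aestronglyMeasurable.mul (hψ.comp measurable_fst).aestronglyMeasurable
    rw [integrable_prod_iff hm]
    refine ⟨hF.prod_right_ae.mono fun x hx => hx.mul_const (ψ x), ?_⟩
    refine h.norm.congr (.of_forall fun x => ?_)
    simp only [norm_mul, Real.norm_of_nonneg (hF0 _), integral_mul_const]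
    rw [Real.norm_of_nonneg (integral_nonneg fun y => hF0 _)]
  refine ⟨hint, ?_⟩
  rw [integral_prod _ hint]
  simp only [integral_mul_const]

theorem gibbs_pointwise {x a b : ℝ} (hx : 0 ≤ x) (ha : 0 ≤ a) (hb : 0 ≤ b)
    (hxa : a = 0 → x = 0) (hxb : b = 0 → x = 0) :
    x * Real.log a + x * Real.log b + x - a * b ≤ x * Real.log x := by
  rcases hx.eq_or_lt with rfl | hx
  · simpa using mul_nonneg ha hb
  have ha : 0 < a := ha.lt_of_ne fun h => hx.ne' (hxa h.symm)
  have hb : 0 < b := hb.lt_of_ne fun h => hx.ne' (hxb h.symm)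
  have h := mul_le_mul_of_nonneg_left
    (Real.log_le_sub_one_of_pos (div_pos (mul_pos ha hb) hx)) hx.le
  rw [Real.log_div (mul_pos ha hb).ne' hx.ne', Real.log_mul ha.ne' hb.ne', mul_sub,
    mul_sub, mul_div_cancel₀ _ hx.ne'] at h
  linarith

/-- Subadditivity of the entropy for a mixture of densities on `X × X` whose average is
symmetric. -/
theorem two_mul_entropy_marginal_le {X Θ : Type*} [MeasurableSpace X] [MeasurableSpace Θ]
    {μ : Measure X} {U : Measure Θ} [IsProbabilityMeasure μ] [IsProbabilityMeasure U]
    {F : (X × X) × Θ → ℝ} (hFm : Measurable F) (hF0 : ∀ p, 0 ≤ F p)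
    (hF : Integrable F ((μ.prod μ).prod U)) (hF1 : ∫ p, F p ∂((μ.prod μ).prod U) = 1)
    (hsymm : ∀ x y, ∫ θ, F ((x, y), θ) ∂U = ∫ θ, F ((y, x), θ) ∂U) {H : X → ℝ}
    (hH : ∀ x, H x = ∫ y, ∫ θ, F ((x, y), θ) ∂U ∂μ)
    (hFF : Integrable (fun p => F p * Real.log (F p)) ((μ.prod μ).prod U))
    (hHH : Integrable (fun x => H x * Real.log (H x)) μ) :
    2 * ∫ x, H x * Real.log (H x) ∂μ ≤ ∫ p, F p * Real.log (F p) ∂((μ.prod μ).prod U) := by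
  have hA0 : ∀ q : X × X, 0 ≤ ∫ θ, F (q, θ) ∂U := fun q => integral_nonneg fun _ => hF0 _
  have hA : Integrable (fun q : X × X => ∫ θ, F (q, θ) ∂U) (μ.prod μ) := hF.integral_prod_left
  have hAm : Measurable (fun q : X × X => ∫ θ, F (q, θ) ∂U) :=
    (hFm.stronglyMeasurable.integral_prod_right').measurable
  have hHm : Measurable H := by
    rw [funext hH]
    exact (hAm.stronglyMeasurable.integral_prod_right').measurable
  have hH0 : ∀ x, 0 ≤ H x := fun x => hH x ▸ integral_nonneg fun y => hA0 _
  have hHi : Integrable H μ := by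
    rw [funext hH]
    exact hA.integral_prod_left
  have hH1 : ∫ x, H x ∂μ = 1 := by
    rw [← hF1, integral_prod _ hF, integral_prod _ hA]
    simp only [hH]
  have left : ∀ φ : X → ℝ, Measurable φ → Integrable (fun x => H x * φ x) μ →
      Integrable (fun p : (X × X) × Θ => F p * φ p.1.1) ((μ.prod μ).prod U) ∧
        ∫ p, F p * φ p.1.1 ∂((μ.prod μ).prod U) = ∫ x, H x * φ x ∂μ := by
    intro φ hφ hi
    simp only [hH] at hi ⊢
    obtain ⟨h1, h2⟩ := integrable_mul_comp_fst hA0 hA hφ hi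
    obtain ⟨h3, h4⟩ := integrable_mul_comp_fst hF0 hF (hφ.comp measurable_fst) h1
    exact ⟨h3, h4.trans h2⟩
  have right : ∀ φ : X → ℝ, Measurable φ → Integrable (fun x => H x * φ x) μ →
      Integrable (fun p : (X × X) × Θ => F p * φ p.1.2) ((μ.prod μ).prod U) ∧
        ∫ p, F p * φ p.1.2 ∂((μ.prod μ).prod U) = ∫ x, H x * φ x ∂μ := by
    intro φ hφ hi
    simp only [hH] at hi ⊢
    obtain ⟨h1, h2⟩ := integrable_mul_comp_fst hA0 hA hφ hi
    have hswap : (fun q : X × X => (∫ θ, F (q, θ) ∂U) * φ q.2) =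
        fun q => (fun p : X × X => (∫ θ, F (p, θ) ∂U) * φ p.1) q.swap := by
      ext ⟨x, y⟩
      simp only [Prod.swap, hsymm x y]
    have h1' : Integrable (fun q : X × X => (∫ θ, F (q, θ) ∂U) * φ q.2) (μ.prod μ) := by
      rw [hswap]; exact h1.swap
    obtain ⟨h3, h4⟩ := integrable_mul_comp_fst hF0 hF (hφ.comp measurable_snd) h1'
    refine ⟨h3, h4.trans (Eq.trans ?_ h2)⟩
    have := integral_prod_swap (μ := μ) (ν := μ)
      (fun p : X × X => (∫ θ, F (p, θ) ∂U) * φ p.1)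
    rw [← this, ← hswap]
    rfl
  set Z : X → ℝ := {x | H x = 0}.indicator 1 with hZ
  have hZm : Measurable Z := measurable_one.indicator (hHm (measurableSet_singleton 0))
  have hZ0 : ∀ x, 0 ≤ Z x := fun x => Set.indicator_nonneg (fun _ _ => zero_le_one) x
  have hZ1 : ∀ x, H x = 0 → Z x = 1 := fun x hx => by simp [hZ, hx]
  have hHZ : (fun x => H x * Z x) = 0 := by
    ext x
    by_cases hx : H x = 0 <;> simp [hZ, hx]
  have hHZi : Integrable (fun x => H x * Z x) μ := by rw [hHZ]; exact integrable_zero _ _ _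
  obtain ⟨z1, z2⟩ := left Z hZm hHZi
  obtain ⟨z3, z4⟩ := right Z hZm hHZi
  simp only [hHZ] at z2 z4
  rw [integral_zero', integral_eq_zero_iff_of_nonneg (fun p => mul_nonneg (hF0 p) (hZ0 _)) z1] at z2
  rw [integral_zero', integral_eq_zero_iff_of_nonneg (fun p => mul_nonneg (hF0 p) (hZ0 _)) z3] at z4
  obtain ⟨l1, l2⟩ := left (fun x => Real.log (H x)) hHm.log hHH
  obtain ⟨r1, r2⟩ := right (fun x => Real.log (H x)) hHm.log hHH
  have hK : Integrable (fun p : (X × X) × Θ => H p.1.1 * H p.1.2) ((μ.prod μ).prod U) :=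
    (hHi.mul_prod hHi).comp_fst U
  have hK1 : ∫ p : (X × X) × Θ, H p.1.1 * H p.1.2 ∂((μ.prod μ).prod U) = 1 := by
    rw [integral_prod _ hK]
    simp [integral_prod_mul, hH1]
  have key := integral_mono_ae (((l1.add r1).add hF).sub hK) hFF (by
    filter_upwards [z2, z4] with p h2 h4
    refine gibbs_pointwise (hF0 p) (hH0 _) (hH0 _) (fun h => ?_) (fun h => ?_)
    · simpa [hZ1 _ h] using h2
    · simpa [hZ1 _ h] using h4)
  rw [integral_sub' ((l1.add r1).add hF) hK, integral_add' (l1.add r1) hF, integral_add' l1 r1,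
    l2, r2, hF1, hK1] at key
  linarith

open ProbabilityTheory in
theorem g_eq_gaussianPDFReal : g = gaussianPDFReal 0 1 := by
  ext v
  simp [g, gaussianPDFReal]

open ProbabilityTheory in
theorem integrable_gaussianReal_iff {f : ℝ → ℝ} :
    Integrable f (gaussianReal 0 1) ↔ Integrable (fun v => g v * f v) := by
  rw [gaussianReal_of_var_ne_zero _ one_ne_zero, g_eq_gaussianPDFReal,
    integrable_withDensity_iff_integrable_smul' (measurable_gaussianPDF _ _)
      (.of_forall fun _ => ENNReal.ofReal_lt_top)]
  simp [toReal_gaussianPDF]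

open ProbabilityTheory in
theorem integral_gaussianReal_eq {f : ℝ → ℝ} :
    ∫ v, f v ∂(gaussianReal 0 1) = ∫ v, g v * f v := by
  rw [integral_gaussianReal_eq_integral_smul one_ne_zero, g_eq_gaussianPDFReal]
  rfl

/-- The uniform probability measure on the angles in `(0, 2π]`. -/
def angleMeasure : Measure ℝ :=
  ENNReal.ofReal (2 * Real.pi)⁻¹ • volume.restrict (Set.Ioc 0 (2 * Real.pi))

instance : IsProbabilityMeasure angleMeasure := by
  constructor
  have h := Real.two_pi_pos
  rw [angleMeasure, Measure.smul_apply, Measure.restrict_apply_univ, Real.volume_Ioc, sub_zero,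
    smul_eq_mul, ← ENNReal.ofReal_mul (inv_nonneg.2 h.le), inv_mul_cancel₀ h.ne',
    ENNReal.ofReal_one]

theorem avg_eq_integral_angleMeasure (f : ℝ → ℝ) : avg f = ∫ θ, f θ ∂angleMeasure := by
  rw [avg, angleMeasure, integral_smul_measure,
    intervalIntegral.integral_of_le Real.two_pi_pos.le,
    ENNReal.toReal_ofReal (inv_nonneg.2 Real.two_pi_pos.le), smul_eq_mul]

theorem avg_rotation_symm (G : ℝ → ℝ) (v w : ℝ) :
    avg (fun θ => G (v * Real.cos θ + w * Real.sin θ)) =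
      avg (fun θ => G (w * Real.cos θ + v * Real.sin θ)) := by
  have hper : Function.Periodic (fun θ => G (w * Real.cos θ + v * Real.sin θ)) (2 * Real.pi) :=
    fun θ => by simp only [Real.cos_add_two_pi, Real.sin_add_two_pi]
  have h := intervalIntegral.integral_comp_sub_left
    (fun θ => G (w * Real.cos θ + v * Real.sin θ)) (a := 0) (b := 2 * Real.pi) (Real.pi / 2)
  simp only [Real.cos_pi_div_two_sub, Real.sin_pi_div_two_sub] at h
  have h' := hper.intervalIntegral_add_eq (Real.pi / 2 - 2 * Real.pi) 0
  rw [sub_add_cancel, zero_add] at h'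
  rw [sub_zero, h'] at h
  simp only [avg, ← h, add_comm]

open ProbabilityTheory in
theorem map_rotation_gaussianReal (θ : ℝ) :
    ((gaussianReal 0 1).prod (gaussianReal 0 1)).map
      (fun q : ℝ × ℝ => q.1 * Real.cos θ + q.2 * Real.sin θ) = gaussianReal 0 1 := by
  have h := gaussianReal_conv_gaussianReal (m₁ := Real.cos θ * 0) (m₂ := Real.sin θ * 0)
    (v₁ := .mk (Real.cos θ ^ 2) (sq_nonneg _) * 1) (v₂ := .mk (Real.sin θ ^ 2) (sq_nonneg _) * 1)
  rw [← gaussianReal_map_const_mul, ← gaussianReal_map_const_mul, Measure.conv,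
    Measure.map_prod_map _ _ (by fun_prop) (by fun_prop),
    Measure.map_map (by fun_prop) (by fun_prop)] at h
  convert h using 2
  · ext q
    simp [mul_comm]
  · simp
  · ext
    simp

open ProbabilityTheory in
theorem measurePreserving_rotation :
    MeasurePreserving (fun p : (ℝ × ℝ) × ℝ => p.1.1 * Real.cos p.2 + p.1.2 * Real.sin p.2)
      (((gaussianReal 0 1).prod (gaussianReal 0 1)).prod angleMeasure) (gaussianReal 0 1) := by
  have hm : Measurable
      (fun p : (ℝ × ℝ) × ℝ => p.1.1 * Real.cos p.2 + p.1.2 * Real.sin p.2) := by fun_prop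
  refine ⟨hm, Measure.ext fun s hs => ?_⟩
  rw [Measure.map_apply hm hs, Measure.prod_apply_symm (hm hs)]
  have h : ∀ θ : ℝ, ((gaussianReal 0 1).prod (gaussianReal 0 1)) ((fun q : ℝ × ℝ => (q, θ)) ⁻¹'
      ((fun p : (ℝ × ℝ) × ℝ => p.1.1 * Real.cos p.2 + p.1.2 * Real.sin p.2) ⁻¹' s)) =
      gaussianReal 0 1 s := fun θ => by
    conv_rhs => rw [← map_rotation_gaussianReal θ, Measure.map_apply (by fun_prop) hs]
    rfl
  simp [h]

/-- the operator T halves the relative entropy: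
∫ g T[G] log T[G] ≤ (1/2) ∫ g G log G. -/
theorem T_entropy_contraction (G : ℝ → ℝ) (hmeas : Measurable G)
    (hpos : ∀ v, 0 ≤ G v) (hprob : ∫ v : ℝ, G v * g v = 1)
    (hentG : Integrable (fun v => g v * G v * Real.log (G v)))
    (hentTG : Integrable (fun v =>
      g v * (∫ w : ℝ, g w * avg (fun θ => G (v * Real.cos θ + w * Real.sin θ)))
        * Real.log (∫ w : ℝ, g w * avg (fun θ => G (v * Real.cos θ + w * Real.sin θ))))) :
    (∫ v : ℝ, g v * (∫ w : ℝ, g w * avg (fun θ => G (v * Real.cos θ + w * Real.sin θ)))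
        * Real.log (∫ w : ℝ, g w * avg (fun θ => G (v * Real.cos θ + w * Real.sin θ))))
      ≤ (1 / 2) * ∫ v : ℝ, g v * G v * Real.log (G v) := by
  have hmp := measurePreserving_rotation
  have hGi : Integrable (fun v => g v * G v) := by
    refine Integrable.congr (Integrable.of_integral_ne_zero (f := fun v => G v * g v) ?_)
      (.of_forall fun v => mul_comm _ _)
    rw [hprob]
    exact one_ne_zero
  simp only [mul_assoc, ← integrable_gaussianReal_iff, ← integral_gaussianReal_eq]
    at hGi hentG hentTG ⊢
  have h := two_mul_entropy_marginal_le (hmeas.comp hmp.measurable) (fun p => hpos _)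
    (hmp.integrable_comp_of_integrable hGi)
    (by
      refine (integral_map (f := G) hmp.aemeasurable ?_).symm.trans ?_
      · exact hmeas.aestronglyMeasurable
      · rw [hmp.map_eq, integral_gaussianReal_eq, ← hprob]
        simp only [mul_comm])
    (fun v w => by
      have := avg_rotation_symm G v w
      rwa [avg_eq_integral_angleMeasure, avg_eq_integral_angleMeasure] at this)
    (fun v => by
      simp only [avg_eq_integral_angleMeasure]
      rfl)
    (hmp.integrable_comp_of_integrable hentG) hentTG
  have hG := integral_map (f := fun v => G v * Real.log (G v)) hmp.aemeasurable
    (hmeas.mul hmeas.log).aestronglyMeasurable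
  rw [hmp.map_eq] at hG
  rw [hG]
  simp only [Function.comp_def] at h
  linarith

end
end

section
/- For every bounded measurable (or nonnegative measurable) G : ℝ → ℝ and every v ∈ ℝ, ∫_ℝ g(w) (2/π)∫₀^{π/2} G(v cos θ + w sin θ) dθ dw = (2/π) ∫₀^{∞} e^{−s}(1−e^{−2s})^{−1/2} P_s[G](v) ds, where P_s[G](v) = ∫_ℝ g(w) G(e^{−s} v + √(1−e^{−2s}) w) dw is the Mehler (Ornstein–Uhlenbeck) semigroup. -/
open MeasureTheory Real
open scoped BigOperators

noncomputable section

theorem integrable_g : Integrable g := by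
  unfold g
  refine Integrable.const_mul ?_ _
  convert integrable_exp_neg_mul_sq (b := 1 / 2) (by norm_num) using 3
  ring

theorem exp_neg_sq (s : ℝ) : Real.exp (-s) ^ 2 = Real.exp (-2 * s) := by
  rw [← Real.exp_nat_mul]
  congr 1
  push_cast
  ring

theorem hasDerivAt_arccos_exp_neg {s : ℝ} (hs : 0 < s) :
    HasDerivAt (fun s => Real.arccos (Real.exp (-s)))
      (Real.exp (-s) * (Real.sqrt (1 - Real.exp (-2 * s)))⁻¹) s := by
  have h₀ : 0 < Real.exp (-s) := Real.exp_pos _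
  have h₁ : Real.exp (-s) < 1 := Real.exp_lt_one_iff.mpr (by linarith)
  refine ((Real.hasDerivAt_arccos (by linarith) h₁.ne).comp s (hasDerivAt_neg s).exp).congr_deriv ?_
  rw [exp_neg_sq]
  ring

theorem injOn_arccos_exp_neg :
    Set.InjOn (fun s => Real.arccos (Real.exp (-s))) (Set.Ioi 0) := by
  intro s hs t ht h
  have hmem : ∀ r ∈ Set.Ioi (0 : ℝ), Real.exp (-r) ∈ Set.Icc (-1 : ℝ) 1 := fun r hr =>
    ⟨by linarith [Real.exp_pos (-r)], (Real.exp_lt_one_iff.mpr (neg_lt_zero.mpr hr)).le⟩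
  exact neg_injective (Real.exp_injective (Real.arccos_injOn (hmem s hs) (hmem t ht) h))

theorem image_arccos_exp_neg :
    (fun s => Real.arccos (Real.exp (-s))) '' Set.Ioi 0 = Set.Ioo 0 (Real.pi / 2) := by
  ext θ
  constructor
  · rintro ⟨s, hs, rfl⟩
    exact ⟨Real.arccos_pos.mpr (Real.exp_lt_one_iff.mpr (neg_lt_zero.mpr hs)),
      Real.arccos_lt_pi_div_two.mpr (Real.exp_pos _)⟩
  · rintro ⟨h₀, h₁⟩
    have hcos : 0 < Real.cos θ := Real.cos_pos_of_mem_Ioo ⟨by linarith, h₁⟩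
    have hlt : Real.cos θ < 1 := by
      simpa using Real.cos_lt_cos_of_nonneg_of_le_pi_div_two le_rfl h₁.le h₀
    refine ⟨-Real.log (Real.cos θ), neg_pos.mpr (Real.log_neg hcos hlt), ?_⟩
    simp only [neg_neg, Real.exp_log hcos]
    exact Real.arccos_cos h₀.le (by linarith)

/-- The change of variables `cos θ = e^{-s}`. -/
theorem integral_zero_pi_div_two_eq_integral_exp_neg (F : ℝ → ℝ → ℝ) :
    ∫ θ in (0:ℝ)..(Real.pi / 2), F (Real.cos θ) (Real.sin θ)
      = ∫ s in Set.Ioi (0:ℝ), Real.exp (-s) * (Real.sqrt (1 - Real.exp (-2 * s)))⁻¹ *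
          F (Real.exp (-s)) (Real.sqrt (1 - Real.exp (-2 * s))) := by
  rw [intervalIntegral.integral_of_le (by positivity), integral_Ioc_eq_integral_Ioo,
    ← image_arccos_exp_neg,
    integral_image_eq_integral_abs_deriv_smul measurableSet_Ioi
      (fun s hs => (hasDerivAt_arccos_exp_neg hs).hasDerivWithinAt) injOn_arccos_exp_neg]
  refine setIntegral_congr_fun measurableSet_Ioi fun s hs => ?_
  have h₁ : Real.exp (-s) < 1 := Real.exp_lt_one_iff.mpr (neg_lt_zero.mpr hs)
  simp only [smul_eq_mul]
  rw [Real.cos_arccos (by linarith [Real.exp_pos (-s)]) h₁.le, Real.sin_arccos, exp_neg_sq,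
    abs_of_nonneg (by positivity)]

theorem integrable_g_mul_comp_rotation {G : ℝ → ℝ} (hmeas : Measurable G) {C : ℝ}
    (hbd : ∀ x, |G x| ≤ C) (v a b : ℝ) :
    Integrable (Function.uncurry fun θ w => g w * G (v * Real.cos θ + w * Real.sin θ))
      ((volume.restrict (Set.uIoc a b)).prod volume) := by
  have : IsFiniteMeasure (volume.restrict (Set.uIoc a b)) := by
    unfold Set.uIoc
    infer_instance
  have hint : Integrable (fun z : ℝ × ℝ => (1 : ℝ) * g z.2)
      ((volume.restrict (Set.uIoc a b)).prod volume) :=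
    Integrable.mul_prod (integrable_const 1) integrable_g
  simp only [one_mul] at hint
  have harg : Measurable fun z : ℝ × ℝ => v * Real.cos z.1 + z.2 * Real.sin z.1 := by
    fun_prop
  exact hint.mul_bdd (hmeas.comp harg).aestronglyMeasurable
    (Filter.Eventually.of_forall fun z => hbd _)

/-- the Mehler / Ornstein–Uhlenbeck representation of the averaged
thermostat operator:
∫ g(w) (2/π)∫₀^{π/2} G(v cos θ + w sin θ) dθ dw
  = (2/π)∫₀^∞ e^{−s}(1−e^{−2s})^{−1/2} P_s[G](v) ds. -/
theorem mehler_representation (G : ℝ → ℝ) (hmeas : Measurable G) (C : ℝ)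
    (hbd : ∀ x, |G x| ≤ C) (v : ℝ) :
    (∫ w : ℝ, g w * ((2 / Real.pi) *
        ∫ θ in (0:ℝ)..(Real.pi / 2), G (v * Real.cos θ + w * Real.sin θ)))
      = (2 / Real.pi) * ∫ s in Set.Ioi (0:ℝ),
          Real.exp (-s) * (Real.sqrt (1 - Real.exp (-2 * s)))⁻¹ *
            ∫ w : ℝ, g w * G (Real.exp (-s) * v + Real.sqrt (1 - Real.exp (-2 * s)) * w) := by
  have hswap := intervalIntegral_integral_swap
    (integrable_g_mul_comp_rotation hmeas hbd v 0 (Real.pi / 2))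
  have hcov := integral_zero_pi_div_two_eq_integral_exp_neg
    fun c s => ∫ w : ℝ, g w * G (v * c + w * s)
  rw [hcov] at hswap
  simp only [intervalIntegral.integral_const_mul] at hswap
  simp only [mul_left_comm (g _) (2 / Real.pi), integral_const_mul]
  rw [← hswap]
  simp only [mul_comm v, mul_comm (Real.sqrt _) _]

end
end
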